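/- Assume the leading-order guiding-ring data. Then for every θ ∈ ℝ: ṽ₀(θ) × DB(x̄)[ρ̂₀(θ)] = ū·( b × DB(x̄)[ρ̂₀(θ)] ) + ( DB(x̄)[ρ̂₀(θ)] · ρ̂₀(θ) )·B(x̄) − ‖B(x̄)‖·( ρ̂₀(θ) · ∇‖B‖(x̄) )·ρ̂₀(θ). -/

import Mathlib

open Real

noncomputable section

abbrev E3 : Type := EuclideanSpace ℝ (Fin 3)

/-- The cross product on `ℝ³`. -/
def cross (u v : E3) : E3 :=
  (WithLp.equiv 2 (Fin 3 → ℝ)).symm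
    ![u 1 * v 2 - u 2 * v 1, u 2 * v 0 - u 0 * v 2, u 0 * v 1 - u 1 * v 0]

/-- The dot product on `ℝ³`. -/
def dot (u v : E3) : ℝ := u 0 * v 0 + u 1 * v 1 + u 2 * v 2

/-- The curl of a vector field on `ℝ³`, defined componentwise from the Fréchet derivative. -/
def curl (A : E3 → E3) (x : E3) : E3 :=
  (WithLp.equiv 2 (Fin 3 → ℝ)).symm
    ![fderiv ℝ A x (EuclideanSpace.single 1 1) 2 - fderiv ℝ A x (EuclideanSpace.single 2 1) 1,
      fderiv ℝ A x (EuclideanSpace.single 2 1) 0 - fderiv ℝ A x (EuclideanSpace.single 0 1) 2,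
      fderiv ℝ A x (EuclideanSpace.single 0 1) 1 - fderiv ℝ A x (EuclideanSpace.single 1 1) 0]

@[simp]
lemma cross_apply_zero (u v : E3) : cross u v 0 = u 1 * v 2 - u 2 * v 1 := rfl

@[simp]
lemma cross_apply_one (u v : E3) : cross u v 1 = u 2 * v 0 - u 0 * v 2 := rfl

@[simp]
lemma cross_apply_two (u v : E3) : cross u v 2 = u 0 * v 1 - u 1 * v 0 := rfl

lemma dot_eq_inner (u v : E3) : dot u v = inner ℝ u v := by
  simp only [dot, PiLp.inner_apply, Fin.sum_univ_three, RCLike.inner_apply, conj_trivial]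
  ring

lemma dot_inv_norm_smul_self {x : E3} (hx : x ≠ 0) :
    dot (‖x‖⁻¹ • x) (‖x‖⁻¹ • x) = 1 := by
  rw [dot_eq_inner, real_inner_self_eq_norm_sq, norm_smul, norm_inv, norm_norm,
    inv_mul_cancel₀ (norm_ne_zero_iff.mpr hx), one_pow]

lemma E3.ext {u v : E3} (h0 : u 0 = v 0) (h1 : u 1 = v 1) (h2 : u 2 = v 2) : u = v := by
  ext i
  fin_cases i
  exacts [h0, h1, h2]

/-- The vector triple product expansion. -/
lemma cross_cross_left (u v z : E3) :
    cross (cross u v) z = dot u z • v - dot v z • u := by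
  apply E3.ext <;> simp [dot] <;> ring

lemma cross_add_left (u v z : E3) : cross (u + v) z = cross u z + cross v z := by
  apply E3.ext <;> simp <;> ring

lemma cross_smul_left (c : ℝ) (u z : E3) : cross (c • u) z = c • cross u z := by
  apply E3.ext <;> simp <;> ring

/-- For a unit vector `b` orthogonal to `w`, crossing the rotating ring direction with `b`
gives the rotating perpendicular velocity. -/
lemma cross_ring_direction {b w : E3} (hb : dot b b = 1) (hw : dot w b = 0) (s c : ℝ) :
    cross (s • w - c • cross w b) b = c • w - s • cross b w := by
  simp only [dot] at hb hw
  apply E3.ext <;> simp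
  · linear_combination c * w 0 * hb - c * b 0 * hw
  · linear_combination c * w 1 * hb - c * b 1 * hw
  · linear_combination c * w 2 * hb - c * b 2 * hw

/-- The gradient of `‖B‖` satisfies `‖B‖ (v · ∇‖B‖) = B · DB[v]`. -/
lemma norm_mul_dot_gradient_norm {B : E3 → E3} {x : E3} (hB : DifferentiableAt ℝ B x)
    (hx : B x ≠ 0) (v : E3) :
    ‖B x‖ * dot v (gradient (fun y => ‖B y‖) x) = dot (B x) (fderiv ℝ B x v) := by
  have hN : DifferentiableAt ℝ (fun y => ‖B y‖) x := hB.norm ℝ hx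
  have h := congrArg (fun L : E3 →L[ℝ] ℝ => L v)
    ((hN.hasFDerivAt.pow 2).unique hB.hasFDerivAt.norm_sq)
  rw [dot_eq_inner, dot_eq_inner, real_inner_comm, gradient,
    InnerProductSpace.toDual_symm_apply]
  simp at h
  linarith

/-- Pointwise identity for the fluctuating Lorentz force on the
leading-order guiding ring:
`v₀(θ) × DB(x̄)[ρ₀(θ)] = ū·(b × DB(x̄)[ρ₀(θ)]) + (DB(x̄)[ρ₀(θ)]·ρ₀(θ))·B(x̄)
  − ‖B(x̄)‖·(ρ₀(θ)·∇‖B‖(x̄))·ρ₀(θ)`. -/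
theorem fluctuating_lorentz_force_identity
    (B : E3 → E3) (hB : ContDiff ℝ 1 B)
    (xbar : E3) (hBx : B xbar ≠ 0)
    (b : E3) (hbdef : b = ‖B xbar‖⁻¹ • B xbar)
    (w : E3) (hw : dot w b = 0) (ubar : ℝ)
    (ρ₀ v₀ : ℝ → E3)
    (hρ₀ : ∀ θ, ρ₀ θ = ‖B xbar‖⁻¹ • (sin θ • w - cos θ • cross w b))
    (hv₀ : ∀ θ, v₀ θ = ubar • b + cos θ • w - sin θ • cross b w)
    :
    ∀ θ : ℝ,
      cross (v₀ θ) (fderiv ℝ B xbar (ρ₀ θ))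
        = ubar • cross b (fderiv ℝ B xbar (ρ₀ θ))
          + dot (fderiv ℝ B xbar (ρ₀ θ)) (ρ₀ θ) • B xbar
          - (‖B xbar‖ * dot (ρ₀ θ) (gradient (fun y => ‖B y‖) xbar)) • ρ₀ θ := by
  intro θ
  have hn : ‖B xbar‖ ≠ 0 := norm_ne_zero_iff.mpr hBx
  have hb : dot b b = 1 := hbdef ▸ dot_inv_norm_smul_self hBx
  have hBb : B xbar = ‖B xbar‖ • b := by rw [hbdef, smul_inv_smul₀ hn]
  have hv : v₀ θ = ubar • b + cross (ρ₀ θ) (B xbar) := by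
    have hρB : cross (ρ₀ θ) (B xbar) = cross (‖B xbar‖ • ρ₀ θ) b := by
      conv_lhs => rw [hBb]
      apply E3.ext <;> simp <;> ring
    rw [hρB, hρ₀, smul_inv_smul₀ hn, cross_ring_direction hb hw, hv₀, add_sub_assoc]
  rw [norm_mul_dot_gradient_norm (hB.differentiable one_ne_zero xbar) hBx, hv, cross_add_left,
    cross_smul_left, cross_cross_left, dot_eq_inner (fderiv ℝ B xbar _), real_inner_comm,
    ← dot_eq_inner, add_sub_assoc]

end
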